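/- Let {a_n}_{n≥0} be periodic with minimal period p ≥ 1, let {t_n} be a solution of t_{n+1} = e^{a_n}/t_n that is periodic with minimal period q ≥ 1 and t_0 > 0, and define g_k(x) = t_k·x·e^{−x} for k = 0, 1, …, q−1 and f = g_{q−1} ∘ … ∘ g_0. If there exists s ∈ (0,∞) such that the orbit {f^n(s)}_{n≥0} is not periodic (i.e., there is no ω ≥ 1 with f^{n+ω}(s) = f^n(s) for all n), then the equation x_{n+1} = x_{n−1}·exp(a_n − x_{n−1} − x_n) has a non-periodic solution; indeed the solution with x_{−1} = s and x_0 = g_0(s) is non-periodic. -/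

import Mathlib

/- compDown g k = g k ∘ g (k-1) ∘ ... ∘ g 0 -/
def compDown (g : ℕ → ℝ → ℝ) : ℕ → (ℝ → ℝ)
  | 0 => g 0
  | k + 1 => g (k + 1) ∘ compDown g k

/-- If `Y` is driven by the maps `g i`, then `compDown g k` sends `Y 0` to `Y (k + 1)`. -/
theorem compDown_apply_of_step (g : ℕ → ℝ → ℝ) (Y : ℕ → ℝ)
    (hY : ∀ i, Y (i + 1) = g i (Y i)) (k : ℕ) : compDown g k (Y 0) = Y (k + 1) := by
  induction k with
  | zero => exact (hY 0).symm
  | succ k ih => rw [compDown, Function.comp_apply, ih, ← hY]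

/- Statement 14 (Lemma pq(b)): {a_n} periodic with minimal period p ≥ 1, {t_n} a solution
of t_{n+1} = e^{a_n}/t_n, periodic with minimal period q ≥ 1, t_0 > 0.  With
g_k(x) = t_k x e^{-x} and f = g_{q-1} ∘ ... ∘ g_0, if s ∈ (0,∞) has a non-periodic orbit
under f, then the solution of (E) with x_{-1} = s and x_0 = g_0(s) = t_0 s e^{-s} is
non-periodic.  We index X : ℕ → ℝ with X n = x_{n-1}. -/
theorem stmt_14 (a : ℕ → ℝ) (p : ℕ) (hp : 1 ≤ p) (hper : Function.Periodic a p)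
    (hmin : ∀ r : ℕ, 0 < r → Function.Periodic a r → p ≤ r)
    (t : ℕ → ℝ) (ht0 : 0 < t 0)
    (htrec : ∀ n : ℕ, t (n + 1) = Real.exp (a n) / t n)
    (q : ℕ) (hq : 1 ≤ q) (htq : ∀ n : ℕ, t (n + q) = t n)
    (htqmin : ∀ r : ℕ, 0 < r → (∀ n : ℕ, t (n + r) = t n) → q ≤ r)
    (f : ℝ → ℝ) (hf : f = compDown (fun k x => t k * x * Real.exp (-x)) (q - 1))
    (s : ℝ) (hs : 0 < s)
    (hsnotper : ¬ ∃ ω : ℕ, 1 ≤ ω ∧ ∀ n : ℕ, f^[n + ω] s = f^[n] s)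
    (X : ℕ → ℝ) (hX0 : X 0 = s) (hX1 : X 1 = t 0 * s * Real.exp (-s))
    (hrec : ∀ n : ℕ, X (n + 2) = X n * Real.exp (a n - X n - X (n + 1))) :
    ¬ ∃ m : ℕ, 1 ≤ m ∧ ∀ n : ℕ, X (n + m) = X n := by
  rintro ⟨m, hm, hXm⟩
  have ht : ∀ n, t n ≠ 0 := by
    intro n
    induction n with
    | zero => exact ht0.ne'
    | succ n ih => rw [htrec]; exact div_ne_zero (Real.exp_ne_zero _) ih
  have hstep : ∀ n, X (n + 1) = t n * X n * Real.exp (-X n) := by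
    intro n
    induction n with
    | zero => rw [hX1, hX0]
    | succ n ih =>
      have hexp : Real.exp (a n - X n - X (n + 1)) =
          Real.exp (a n) * Real.exp (-X n) * Real.exp (-X (n + 1)) := by
        rw [← Real.exp_add, ← Real.exp_add, ← sub_eq_add_neg, ← sub_eq_add_neg]
      have htt : t (n + 1) * t n = Real.exp (a n) := by
        rw [htrec, div_mul_cancel₀ _ (ht n)]
      calc X (n + 2) = t (n + 1) * (t n * X n * Real.exp (-X n)) * Real.exp (-X (n + 1)) := by
            rw [hrec, hexp, ← htt]; ring
        _ = t (n + 1) * X (n + 1) * Real.exp (-X (n + 1)) := by rw [← ih]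
  have htmul : ∀ n i, t (n * q + i) = t i := by
    intro n i
    rw [add_comm]
    exact Function.Periodic.nat_mul (f := t) htq n i
  have horbit : ∀ n, f^[n] s = X (n * q) := by
    intro n
    induction n with
    | zero => simp [hX0]
    | succ n ih =>
      have h := compDown_apply_of_step (fun k x => t k * x * Real.exp (-x))
        (fun i => X (n * q + i)) (fun i => by rw [← add_assoc, hstep, htmul]) (q - 1)
      rw [Nat.sub_add_cancel hq, add_zero, ← hf, ← Nat.succ_mul] at h
      rw [Function.iterate_succ_apply', ih, h]
  refine hsnotper ⟨m, hm, fun n => ?_⟩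
  rw [horbit, horbit, add_mul, mul_comm m q]
  exact Function.Periodic.nat_mul (f := X) hXm q (n * q)
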